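/- arXiv:2604.12363 — 3 statements merged into one kernel-verified Lean document; each statement's English description precedes it below -/
import Mathlib

section
/- Let N ≥ 1 be an integer and let H be a finite simple graph containing a vertex z with deg_H(z) ≤ 3N, together with, for each i ∈ {1, …, N}, distinct vertices s_i, t_i such that z s_i, z t_i, s_i t_i ∈ E(H), and such that the neighbors of s_i other than z and t_i are exactly the middle vertices of N + i − 1 suspended paths at s_i, the neighbors of t_i other than z and s_i are exactly the middle vertices of N + i − 1 suspended paths at t_i, and all the vertices s_i, t_i and their suspended-path vertices (over all i) are pairwise distinct and distinct from z. Then every proper weight function w : E(H) → {0,1} satisfies color_w(z) = N and w(e) = 0 for every edge e incident to z other than the 2N edges z s_i, z t_i (i ∈ {1, …, N}). -/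
variable {V : Type*}

/-- The color of a vertex `v` induced by a `{0,1}`-edge-weighting `w`:
the sum of the weights of the edges of `G` incident to `v`. -/
noncomputable def vcColor [Finite V] (G : SimpleGraph V) (w : Sym2 V → Fin 2) (v : V) : ℕ :=
  ∑ e ∈ (G.incidenceSet v).toFinite.toFinset, (w e : ℕ)

/-- A weight function is proper if adjacent vertices get distinct colors. -/
def vcProper [Finite V] (G : SimpleGraph V) (w : Sym2 V → Fin 2) : Prop :=
  ∀ u v : V, G.Adj u v → vcColor G w u ≠ vcColor G w v

/-- `S` is a vertex cover of `G`. -/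
def IsVertexCover (G : SimpleGraph V) (S : Set V) : Prop :=
  ∀ ⦃u v : V⦄, G.Adj u v → u ∈ S ∨ v ∈ S

/-- Degree of a vertex in a (not necessarily decidable) graph. -/
noncomputable def subDeg (H : SimpleGraph V) (v : V) : ℕ := (H.neighborSet v).ncard

/-- Index type naming the vertices of the shared gadget at `z`: for each `i`,
a triangle `z, sᵢ, tᵢ` with suspended paths (middle `sm/tm`, end `se/te`) attached
to `sᵢ` and `tᵢ`. -/
inductive Idx9 : Type where
  | z : Idx9
  | s : ℕ → Idx9
  | t : ℕ → Idx9
  | sm : ℕ → ℕ → Idx9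
  | se : ℕ → ℕ → Idx9
  | tm : ℕ → ℕ → Idx9
  | te : ℕ → ℕ → Idx9

/-- Valid indices: `i ∈ {1, …, N}`, and at `sᵢ`/`tᵢ` the suspended paths are
indexed by `j ∈ {1, …, N + i − 1}`. -/
def Idx9.Valid (N : ℕ) : Idx9 → Prop
  | .z => True
  | .s i => 1 ≤ i ∧ i ≤ N
  | .t i => 1 ≤ i ∧ i ≤ N
  | .sm i j => (1 ≤ i ∧ i ≤ N) ∧ (1 ≤ j ∧ j ≤ N + i - 1)
  | .se i j => (1 ≤ i ∧ i ≤ N) ∧ (1 ≤ j ∧ j ≤ N + i - 1)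
  | .tm i j => (1 ≤ i ∧ i ≤ N) ∧ (1 ≤ j ∧ j ≤ N + i - 1)
  | .te i j => (1 ≤ i ∧ i ≤ N) ∧ (1 ≤ j ∧ j ≤ N + i - 1)

theorem vcColor_eq_sum_neighbors [Finite V] (G : SimpleGraph V) (w : Sym2 V → Fin 2) (v : V) :
    vcColor G w v = ∑ u ∈ (G.neighborSet v).toFinite.toFinset, (w s(v, u) : ℕ) := by
  classical
  have himage : (G.incidenceSet v).toFinite.toFinset =
      (G.neighborSet v).toFinite.toFinset.image (fun u => s(v, u)) := by
    ext e
    simp only [Set.Finite.mem_toFinset, Finset.mem_image, SimpleGraph.mem_neighborSet]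
    constructor
    · rintro ⟨he, hv⟩
      obtain ⟨u, rfl⟩ := Sym2.mem_iff_exists.mp hv
      exact ⟨u, he, rfl⟩
    · rintro ⟨u, hu, rfl⟩
      exact ⟨hu, Sym2.mem_mk_left v u⟩
  rw [vcColor, himage, Finset.sum_image]
  intro a _ b _ hab
  exact Sym2.congr_right.mp hab

/-- The first edge of a suspended path gets weight `1` under every proper weighting. -/
theorem vcProper.suspended_edge_eq_one [Finite V] {G : SimpleGraph V} {w : Sym2 V → Fin 2}
    (hp : vcProper G w) {u x y : V} (hux : G.Adj u x) (hxy : G.Adj x y) (huy : u ≠ y)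
    (hx : subDeg G x = 2) (hy : subDeg G y = 1) : (w s(u, x) : ℕ) = 1 := by
  classical
  have hnx : ({u, y} : Set V) = G.neighborSet x := by
    apply Set.eq_of_subset_of_ncard_le _ _ (Set.toFinite _)
    · rintro a (rfl | rfl)
      · exact hux.symm
      · exact hxy
    · rw [Set.ncard_pair huy]
      exact hx.le
  have hny : ({x} : Set V) = G.neighborSet y := by
    apply Set.eq_of_subset_of_ncard_le _ _ (Set.toFinite _)
    · rintro a rfl
      exact hxy.symm
    · rw [Set.ncard_singleton]
      exact hy.le
  have hfx : (G.neighborSet x).toFinite.toFinset = {u, y} := by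
    ext a
    simp [← hnx]
  have hfy : (G.neighborSet y).toFinite.toFinset = {x} := by
    ext a
    simp [← hny]
  have h := hp x y hxy
  rw [vcColor_eq_sum_neighbors, vcColor_eq_sum_neighbors, hfx, hfy, Finset.sum_pair huy,
    Finset.sum_singleton, Sym2.eq_swap (a := y), Sym2.eq_swap (a := x) (b := u)] at h
  have := (w s(u, x)).isLt
  omega

/-- The color of a vertex with two distinguished neighbors, all of whose remaining `k` edges
have weight `1`. -/
theorem vcColor_eq_of_neighborSet_eq [Finite V] {G : SimpleGraph V} {w : Sym2 V → Fin 2}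
    {u a b : V} {k : ℕ} {f : ℕ → V}
    (hn : G.neighborSet u = {a, b} ∪ f '' Set.Icc 1 k) (hab : a ≠ b)
    (hf : Set.InjOn f (Set.Icc 1 k)) (ha : ∀ j ∈ Set.Icc 1 k, f j ≠ a)
    (hb : ∀ j ∈ Set.Icc 1 k, f j ≠ b) (hw : ∀ j ∈ Set.Icc 1 k, (w s(u, f j) : ℕ) = 1) :
    vcColor G w u = w s(u, a) + w s(u, b) + k := by
  classical
  have hfin : (G.neighborSet u).toFinite.toFinset =
      {a, b} ∪ (Finset.Icc 1 k).image f := by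
    ext x
    simp [hn]
  have hdisj : Disjoint ({a, b} : Finset V) ((Finset.Icc 1 k).image f) := by
    rw [Finset.disjoint_right]
    intro x hx
    obtain ⟨j, hj, rfl⟩ := Finset.mem_image.mp hx
    have hj' : j ∈ Set.Icc 1 k := by simpa using hj
    simp [ha j hj', hb j hj']
  rw [vcColor_eq_sum_neighbors, hfin, Finset.sum_union hdisj, Finset.sum_pair hab,
    Finset.sum_image (by simpa using hf),
    Finset.sum_congr rfl (fun j hj => hw j (by simpa using hj))]
  simp

/-- With `N` type-A gadgets attached at `z` (the `i`-th disallowing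
color `N + i`) and `deg(z) ≤ 3N`, every proper weighting gives `z` the color `N` and
gives weight `0` to every edge at `z` other than the `2N` gadget edges `z sᵢ, z tᵢ`. -/
theorem stmt_9 [Finite V] (H : SimpleGraph V) (N : ℕ) (hN : 1 ≤ N)
    (F : Idx9 → V) (hinj : Set.InjOn F {i | Idx9.Valid N i})
    (hdz : subDeg H (F .z) ≤ 3 * N)
    (htri : ∀ i ∈ Set.Icc 1 N,
      H.Adj (F .z) (F (.s i)) ∧ H.Adj (F .z) (F (.t i)) ∧ H.Adj (F (.s i)) (F (.t i)))
    (hns : ∀ i ∈ Set.Icc 1 N, H.neighborSet (F (.s i)) =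
      {F .z, F (.t i)} ∪ (fun j => F (.sm i j)) '' Set.Icc 1 (N + i - 1))
    (hnt : ∀ i ∈ Set.Icc 1 N, H.neighborSet (F (.t i)) =
      {F .z, F (.s i)} ∪ (fun j => F (.tm i j)) '' Set.Icc 1 (N + i - 1))
    (hps : ∀ i ∈ Set.Icc 1 N, ∀ j ∈ Set.Icc 1 (N + i - 1),
      H.Adj (F (.s i)) (F (.sm i j)) ∧ H.Adj (F (.sm i j)) (F (.se i j)) ∧
      subDeg H (F (.sm i j)) = 2 ∧ subDeg H (F (.se i j)) = 1)
    (hpt : ∀ i ∈ Set.Icc 1 N, ∀ j ∈ Set.Icc 1 (N + i - 1),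
      H.Adj (F (.t i)) (F (.tm i j)) ∧ H.Adj (F (.tm i j)) (F (.te i j)) ∧
      subDeg H (F (.tm i j)) = 2 ∧ subDeg H (F (.te i j)) = 1)
    (w : Sym2 V → Fin 2) (hp : vcProper H w) :
    vcColor H w (F .z) = N ∧
    ∀ u : V, H.Adj (F .z) u →
      (∀ i ∈ Set.Icc 1 N, u ≠ F (.s i) ∧ u ≠ F (.t i)) →
      w s(F .z, u) = 0 := by
  classical
  have hne : ∀ {a b : Idx9}, a.Valid N → b.Valid N → a ≠ b → F a ≠ F b :=
    fun ha hb hab h => hab (hinj ha hb h)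
  have hcs : ∀ i ∈ Set.Icc 1 N, vcColor H w (F (.s i)) =
      w s(F (.s i), F .z) + w s(F (.s i), F (.t i)) + (N + i - 1) := by
    intro i hi
    refine vcColor_eq_of_neighborSet_eq (hns i hi) (hne trivial hi (by simp)) ?_
      (fun j hj => hne ⟨hi, hj⟩ trivial (by simp)) (fun j hj => hne ⟨hi, hj⟩ hi (by simp)) ?_
    · intro j hj k hk hjk
      simpa using hinj (show Idx9.Valid N (.sm i j) from ⟨hi, hj⟩)
        (show Idx9.Valid N (.sm i k) from ⟨hi, hk⟩) hjk
    · intro j hj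
      obtain ⟨h₁, h₂, h₃, h₄⟩ := hps i hi j hj
      exact hp.suspended_edge_eq_one h₁ h₂ (hne hi ⟨hi, hj⟩ (by simp)) h₃ h₄
  have hct : ∀ i ∈ Set.Icc 1 N, vcColor H w (F (.t i)) =
      w s(F (.t i), F .z) + w s(F (.t i), F (.s i)) + (N + i - 1) := by
    intro i hi
    refine vcColor_eq_of_neighborSet_eq (hnt i hi) (hne trivial hi (by simp)) ?_
      (fun j hj => hne ⟨hi, hj⟩ trivial (by simp)) (fun j hj => hne ⟨hi, hj⟩ hi (by simp)) ?_
    · intro j hj k hk hjk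
      simpa using hinj (show Idx9.Valid N (.tm i j) from ⟨hi, hj⟩)
        (show Idx9.Valid N (.tm i k) from ⟨hi, hk⟩) hjk
    · intro j hj
      obtain ⟨h₁, h₂, h₃, h₄⟩ := hpt i hi j hj
      exact hp.suspended_edge_eq_one h₁ h₂ (hne hi ⟨hi, hj⟩ (by simp)) h₃ h₄
  have hgadget : ∀ i ∈ Set.Icc 1 N,
      (w s(F .z, F (.s i)) : ℕ) + w s(F .z, F (.t i)) = 1 ∧ vcColor H w (F .z) ≠ N + i := by
    intro i hi
    obtain ⟨hzs, hzt, hst⟩ := htri i hi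
    have h₁ := hp _ _ hzs
    have h₂ := hp _ _ hzt
    have h₃ := hp _ _ hst
    rw [hcs i hi, Sym2.eq_swap (a := F (.s i)) (b := F .z)] at h₁ h₃
    rw [hct i hi, Sym2.eq_swap (a := F (.t i)) (b := F .z),
      Sym2.eq_swap (a := F (.t i)) (b := F (.s i))] at h₂ h₃
    have := (w s(F .z, F (.s i))).isLt
    have := (w s(F .z, F (.t i))).isLt
    have := (w s(F (.s i), F (.t i))).isLt
    have := hi.1
    omega
  have hinjs : Set.InjOn (fun i => F (.s i)) (Finset.Icc 1 N : Finset ℕ) := by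
    intro i hi j hj hij
    simpa using hinj (show Idx9.Valid N (.s i) by simpa [Idx9.Valid] using hi)
      (show Idx9.Valid N (.s j) by simpa [Idx9.Valid] using hj) hij
  have hinjt : Set.InjOn (fun i => F (.t i)) (Finset.Icc 1 N : Finset ℕ) := by
    intro i hi j hj hij
    simpa using hinj (show Idx9.Valid N (.t i) by simpa [Idx9.Valid] using hi)
      (show Idx9.Valid N (.t j) by simpa [Idx9.Valid] using hj) hij
  set S := (Finset.Icc 1 N).image (fun i => F (.s i)) with hS
  set T := (Finset.Icc 1 N).image (fun i => F (.t i)) with hT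
  have hdisj : Disjoint S T := by
    rw [Finset.disjoint_left]
    intro x hx hx'
    obtain ⟨i, hi, rfl⟩ := Finset.mem_image.mp hx
    obtain ⟨j, hj, hij⟩ := Finset.mem_image.mp hx'
    exact hne (show Idx9.Valid N (.t j) from Finset.mem_Icc.mp hj)
      (show Idx9.Valid N (.s i) from Finset.mem_Icc.mp hi) (by simp) hij
  have hcard : (S ∪ T).card = 2 * N := by
    rw [Finset.card_union_of_disjoint hdisj, hS, hT, Finset.card_image_of_injOn hinjs,
      Finset.card_image_of_injOn hinjt, Nat.card_Icc]
    omega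
  have hsum : ∑ u ∈ S ∪ T, (w s(F .z, u) : ℕ) = N := by
    rw [Finset.sum_union hdisj, hS, hT, Finset.sum_image hinjs, Finset.sum_image hinjt,
      ← Finset.sum_add_distrib,
      Finset.sum_congr rfl (fun i hi => (hgadget i (Finset.mem_Icc.mp hi)).1)]
    simp
  set A := (H.neighborSet (F .z)).toFinite.toFinset with hA
  have hsub : S ∪ T ⊆ A := by
    intro x hx
    rw [hA, Set.Finite.mem_toFinset]
    rcases Finset.mem_union.mp hx with hx | hx
    · obtain ⟨i, hi, rfl⟩ := Finset.mem_image.mp hx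
      exact (htri i (Finset.mem_Icc.mp hi)).1
    · obtain ⟨i, hi, rfl⟩ := Finset.mem_image.mp hx
      exact (htri i (Finset.mem_Icc.mp hi)).2.1
  have hcardA : A.card ≤ 3 * N := by
    rwa [hA, ← Set.ncard_eq_toFinset_card]
  have hcolor : vcColor H w (F .z) = ∑ u ∈ A \ (S ∪ T), (w s(F .z, u) : ℕ) + N := by
    rw [vcColor_eq_sum_neighbors, ← Finset.sum_sdiff hsub, hsum]
  have hrest : ∑ u ∈ A \ (S ∪ T), (w s(F .z, u) : ℕ) ≤ N := by
    calc ∑ u ∈ A \ (S ∪ T), (w s(F .z, u) : ℕ)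
        ≤ ∑ u ∈ A \ (S ∪ T), 1 :=
          Finset.sum_le_sum fun u _ => Nat.le_of_lt_succ (w s(F .z, u)).isLt
      _ = (A \ (S ∪ T)).card := by simp
      _ ≤ N := by
        rw [Finset.card_sdiff_of_subset hsub]
        omega
  have hzero : ∑ u ∈ A \ (S ∪ T), (w s(F .z, u) : ℕ) = 0 := by
    by_contra h
    exact (hgadget _ ⟨Nat.pos_of_ne_zero h, hrest⟩).2 (by rw [hcolor, add_comm])
  refine ⟨by rw [hcolor, hzero, zero_add], fun u hu hout => ?_⟩
  have hmem : u ∈ A \ (S ∪ T) := by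
    rw [Finset.mem_sdiff, hA, Set.Finite.mem_toFinset]
    refine ⟨hu, fun h => ?_⟩
    rcases Finset.mem_union.mp h with h | h
    · obtain ⟨i, hi, rfl⟩ := Finset.mem_image.mp h
      exact (hout i (Finset.mem_Icc.mp hi)).1 rfl
    · obtain ⟨i, hi, rfl⟩ := Finset.mem_image.mp h
      exact (hout i (Finset.mem_Icc.mp hi)).2 rfl
  exact Fin.ext (Finset.sum_eq_zero_iff.mp hzero u hmem)
end

section
/- Let G be a finite simple graph admitting a vertex cover of size at most k, and let E₁ ⊆ E(G). For a vertex v, let base(v) denote the number of edges of E₁ incident to v. If there exists a proper weight function w : E(G) → {0,1} with w(e) = 1 for every e ∈ E₁, then there exists a proper weight function ŵ : E(G) → {0,1} with ŵ(e) = 1 for every e ∈ E₁ and color_ŵ(v) − base(v) ≤ 8k² + 8k for every vertex v of G. -/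
variable {V : Type*}

/-- `baseColor E₁ v` is the number of edges of `E₁` incident to `v`. -/
noncomputable def baseColor (E₁ : Set (Sym2 V)) (v : V) : ℕ := {e ∈ E₁ | v ∈ e}.ncard

theorem vcColor_eq_ncard [Finite V] (G : SimpleGraph V) (w : Sym2 V → Fin 2) (v : V) :
    vcColor G w v = {u | G.Adj v u ∧ w s(v, u) = 1}.ncard := by
  classical
  have hval (a : Fin 2) : (a : ℕ) = if a = 1 then 1 else 0 := by
    fin_cases a <;> rfl
  unfold vcColor
  simp_rw [hval]
  rw [← Finset.card_filter, ← Set.ncard_coe_finset]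
  symm
  refine Set.ncard_congr (fun u _ => s(v, u)) ?_ ?_ ?_
  · rintro u ⟨hu, hw⟩
    simp [SimpleGraph.incidenceSet, hu, hw]
  · rintro a b _ _ h
    exact Sym2.congr_right.1 h
  · intro e he
    simp only [Finset.coe_filter, Set.Finite.mem_toFinset, Set.mem_ofPred_eq] at he
    obtain ⟨⟨he, hv⟩, hw⟩ := he
    obtain ⟨u, rfl⟩ := hv
    exact ⟨u, ⟨he, hw⟩, rfl⟩

theorem ncard_le_baseColor [Finite V] (E₁ : Set (Sym2 V)) (v : V) :
    {u | s(v, u) ∈ E₁}.ncard ≤ baseColor E₁ v := by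
  unfold baseColor
  refine Set.ncard_le_ncard_of_injOn (fun u => s(v, u)) ?_ ?_ (Set.toFinite _)
  · intro u hu
    exact ⟨hu, Sym2.mem_mk_left v u⟩
  · intro a _ b _ h
    exact Sym2.congr_right.1 h

theorem vcColor_le_ncard_of_notMem [Finite V] {G : SimpleGraph V} {S : Set V}
    (hvc : IsVertexCover G S) (w : Sym2 V → Fin 2) {v : V} (hv : v ∉ S) :
    vcColor G w v ≤ S.ncard := by
  rw [vcColor_eq_ncard]
  exact Set.ncard_le_ncard fun u hu => (hvc hu.1).resolve_left hv

/-- Lists that are at least as long as the number of indices have a system of distinct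
representatives. -/
theorem exists_injOn_of_ncard_le {ι : Type*} [Finite ι] (R : Set ι) (C : ι → Finset ℕ)
    (hC : ∀ s ∈ R, R.ncard ≤ (C s).card) :
    ∃ c : ι → ℕ, Set.InjOn c R ∧ ∀ s ∈ R, c s ∈ C s := by
  classical
  obtain ⟨f, hf, hfC⟩ :=
    (Finset.all_card_le_biUnion_card_iff_exists_injective (fun s : R => C s)).1 (by
      intro T
      obtain rfl | ⟨r, hr⟩ := T.eq_empty_or_nonempty
      · simp
      · calc T.card = (T : Set R).ncard := (Set.ncard_coe_finset T).symm
          _ ≤ (Set.univ : Set R).ncard := Set.ncard_le_ncard (Set.subset_univ _)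
          _ = R.ncard := Set.ncard_univ R
          _ ≤ (C r).card := hC r r.2
          _ ≤ _ := Finset.card_le_card (Finset.subset_biUnion_of_mem (fun s : R => C s) hr))
  refine ⟨fun s => if h : s ∈ R then f ⟨s, h⟩ else 0, ?_, ?_⟩
  · intro a ha b hb h
    simp only [ha, hb, dif_pos] at h
    exact congrArg Subtype.val (hf h)
  · intro s hs
    simpa only [hs, dif_pos] using hfC ⟨s, hs⟩

/-- Any family of finite sets has a subfamily whose union is small and outside of which every other
member of the family is large. -/
theorem exists_subset_ncard_biUnion_le {α β : Type*} [Finite α] [Finite β] (L : Set α)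
    (N : α → Set β) (M : ℕ) :
    ∃ A ⊆ L, (⋃ s ∈ A, N s).ncard ≤ M * A.ncard ∧
      ∀ s ∈ L, s ∉ A → M < (N s \ ⋃ s ∈ A, N s).ncard := by
  obtain ⟨A, ⟨hAL, hA⟩, hmax⟩ := Set.exists_max_image
    {A : Set α | A ⊆ L ∧ (⋃ s ∈ A, N s).ncard ≤ M * A.ncard} Set.ncard (Set.toFinite _)
    ⟨∅, by simp⟩
  refine ⟨A, hAL, hA, fun s hs hsA => ?_⟩
  by_contra! hle
  have hcard := Set.ncard_insert_of_notMem hsA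
  have := hmax (insert s A) ⟨Set.insert_subset hs hAL, ?_⟩
  · lia
  · rw [Set.biUnion_insert, ← Set.sdiff_union_self, hcard, mul_add, mul_one]
    exact (Set.ncard_union_le _ _).trans (by lia)

open Classical in
/-- The weighting that agrees with `w`, except that on the edges joining a vertex `s ∈ R` to `F s`
it takes the value `1` exactly on those ending in `X s`. -/
noncomputable def reweight (w : Sym2 V → Fin 2) (R : Set V) (F X : V → Set V) (e : Sym2 V) :
    Fin 2 :=
  if ∃ s ∈ R, ∃ u ∈ X s, e = s(s, u) then 1
  else if ∃ s ∈ R, ∃ u ∈ F s, e = s(s, u) then 0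
  else w e

section reweight

variable {w : Sym2 V → Fin 2} {R S : Set V} {F X : V → Set V}

theorem reweight_eq_self (hXF : ∀ s, X s ⊆ F s) {e : Sym2 V}
    (he : ∀ s ∈ R, ∀ u ∈ F s, e ≠ s(s, u)) : reweight w R F X e = w e := by
  unfold reweight
  rw [if_neg, if_neg]
  · rintro ⟨s, hs, u, hu, h⟩
    exact he s hs u hu h
  · rintro ⟨s, hs, u, hu, h⟩
    exact he s hs u (hXF s hu) h

theorem vcColor_reweight_eq_self [Finite V] (G : SimpleGraph V) (hXF : ∀ s, X s ⊆ F s) {v : V}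
    (hvR : v ∉ R) (hvF : ∀ s ∈ R, v ∉ F s) :
    vcColor G (reweight w R F X) v = vcColor G w v := by
  have h (u : V) : reweight w R F X s(v, u) = w s(v, u) := by
    refine reweight_eq_self hXF fun s hs t ht h => ?_
    rcases Sym2.eq_iff.1 h with ⟨rfl, -⟩ | ⟨rfl, -⟩
    · exact hvR hs
    · exact hvF s hs ht
  simp_rw [vcColor_eq_ncard, h]

theorem vcColor_reweight_of_mem [Finite V] (G : SimpleGraph V) (hXF : ∀ s, X s ⊆ F s)
    (hRS : R ⊆ S) (hFS : ∀ s, Disjoint (F s) S) (hFG : ∀ s, F s ⊆ {u | G.Adj s u}) {s : V}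
    (hs : s ∈ R) :
    vcColor G (reweight w R F X) s =
      {u | G.Adj s u ∧ w s(s, u) = 1 ∧ u ∉ F s}.ncard + (X s).ncard := by
  have hF (s u : V) (hu : u ∈ F s) : u ∉ S := Set.disjoint_left.1 (hFS s) hu
  have key (Y : V → Set V) (hY : ∀ s, Y s ⊆ F s) (u : V) :
      (∃ t ∈ R, ∃ v ∈ Y t, s(s, u) = s(t, v)) ↔ u ∈ Y s := by
    constructor
    · rintro ⟨t, ht, v, hv, h⟩
      rcases Sym2.eq_iff.1 h with ⟨rfl, rfl⟩ | ⟨rfl, rfl⟩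
      · exact hv
      · exact absurd (hRS hs) (hF _ _ (hY _ hv))
    · exact fun hu => ⟨s, hs, u, hu, rfl⟩
  classical
  have hre (u : V) : reweight w R F X s(s, u) =
      if u ∈ X s then 1 else if u ∈ F s then 0 else w s(s, u) := by
    unfold reweight
    exact if_congr (key X hXF u) rfl (if_congr (key F (fun _ => subset_rfl) u) rfl rfl)
  rw [vcColor_eq_ncard, ← Set.ncard_union_eq]
  · congr 1
    ext u
    have hXu := @hXF s u
    have hGu : u ∈ F s → G.Adj s u := @hFG s u
    simp only [Set.mem_ofPred_eq, Set.mem_union, hre]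
    by_cases h1 : u ∈ X s
    · simp [h1, hGu (hXu h1)]
    · by_cases h2 : u ∈ F s <;> simp [h1, h2]
  · exact Set.disjoint_left.2 fun u hu hX => hu.2.2 (hXF s hX)

end reweight

/-- If `G` has a vertex cover of size at most `k` and admits a proper
weighting extending the all-ones pre-weighting on `E₁`, then it admits such a weighting
in which every vertex `v` has color at most `base(v) + 8k² + 8k`. -/
theorem stmt_11 [Finite V] (G : SimpleGraph V) (k : ℕ) (S : Set V)
    (hvc : IsVertexCover G S) (hS : S.ncard ≤ k)
    (E₁ : Set (Sym2 V)) (hE₁ : E₁ ⊆ G.edgeSet)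
    (hex : ∃ w : Sym2 V → Fin 2, vcProper G w ∧ ∀ e ∈ E₁, w e = 1) :
    ∃ w2 : Sym2 V → Fin 2, vcProper G w2 ∧ (∀ e ∈ E₁, w2 e = 1) ∧
      ∀ v : V, vcColor G w2 v - baseColor E₁ v ≤ 8 * k ^ 2 + 8 * k := by
  obtain ⟨w, hw, hwE⟩ := hex
  classical
  -- `A` consists of vertices of small color with few neighbors outside `S`; `P` is the set of those
  -- neighbors, and all edges meeting `P` keep their weight.
  obtain ⟨A, hAL, hPA, hA⟩ := exists_subset_ncard_biUnion_le {s | s ∈ S ∧ vcColor G w s ≤ k}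
    (fun s => {u | G.Adj s u ∧ u ∉ S}) (3 * k)
  set P := ⋃ s ∈ A, {u | G.Adj s u ∧ u ∉ S} with hP
  have hPS {u : V} (hu : u ∈ P) : u ∉ S := by
    simp only [hP, Set.mem_iUnion] at hu
    obtain ⟨_, _, _, hu⟩ := hu
    exact hu
  have hPcard : P.ncard ≤ 3 * k ^ 2 := by
    have : A.ncard ≤ k := (Set.ncard_le_ncard fun s hs => (hAL hs).1).trans hS
    calc _ ≤ _ := hPA
      _ ≤ 3 * k * k := Nat.mul_le_mul_left _ this
      _ = _ := by ring
  let F : V → Set V := fun s => {u | G.Adj s u ∧ u ∉ S ∧ u ∉ P ∧ s(s, u) ∉ E₁}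
  let D : V → Set V := fun s => {u | G.Adj s u ∧ w s(s, u) = 1 ∧ u ∉ F s}
  let R : Set V := {s | s ∈ S ∧ 2 * k < (F s).ncard}
  have hFA {s : V} (hs : s ∈ A) : F s = ∅ := by
    refine Set.eq_empty_of_forall_notMem fun u hu => hu.2.2.1 ?_
    exact Set.mem_biUnion hs ⟨hu.1, hu.2.1⟩
  have hDcard (s : V) : (D s).ncard ≤ baseColor E₁ s + (k + 3 * k ^ 2) := by
    have hsub : D s ⊆ {u | s(s, u) ∈ E₁} ∪ (S ∪ P) := by
      rintro u ⟨hu, -, hF⟩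
      by_contra hn
      simp only [Set.mem_union, not_or] at hn
      exact hF ⟨hu, hn.2.1, hn.2.2, hn.1⟩
    have h1 := Set.ncard_le_ncard hsub
    have h2 := Set.ncard_union_le {u | s(s, u) ∈ E₁} (S ∪ P)
    have h3 := Set.ncard_union_le S P
    have h4 := ncard_le_baseColor E₁ s
    lia
  have hwD (s : V) : vcColor G w s ≤ (D s).ncard + (F s).ncard := by
    rw [vcColor_eq_ncard]
    refine (Set.ncard_le_ncard fun u hu => ?_).trans (Set.ncard_union_le _ _)
    by_cases h : u ∈ F s
    · exact Or.inr h
    · exact Or.inl ⟨hu.1, hu.2, h⟩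
  -- A vertex of the cover outside `A` and `R` has a large color.
  have hlarge {s : V} (hs : s ∈ S) (hsA : s ∉ A) (hsR : s ∉ R) : k < vcColor G w s := by
    by_contra! hle
    have h1 := hA s ⟨hs, hle⟩ hsA
    have h2 : (F s).ncard ≤ 2 * k := by
      by_contra! h
      exact hsR ⟨hs, h⟩
    have hsub : {u | G.Adj s u ∧ u ∉ S} \ P ⊆ F s ∪ {u | G.Adj s u ∧ w s(s, u) = 1} := by
      rintro u ⟨⟨hu, huS⟩, huP⟩
      by_cases h : s(s, u) ∈ E₁
      · exact Or.inr ⟨hu, hwE _ h⟩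
      · exact Or.inl ⟨hu, huS, huP, h⟩
    have h3 := (Set.ncard_le_ncard hsub).trans (Set.ncard_union_le _ _)
    rw [← vcColor_eq_ncard] at h3
    lia
  obtain ⟨c, hcinj, hc⟩ := exists_injOn_of_ncard_le R
    (fun s => (Finset.Icc (D s).ncard ((D s).ncard + 2 * k) \ Finset.range (k + 1)) \
      (S \ R).toFinite.toFinset.image (vcColor G w)) (by
      intro s _
      have h1 := Finset.le_card_sdiff (Finset.range (k + 1))
        (Finset.Icc (D s).ncard ((D s).ncard + 2 * k))
      have h2 := Finset.le_card_sdiff ((S \ R).toFinite.toFinset.image (vcColor G w))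
        (Finset.Icc (D s).ncard ((D s).ncard + 2 * k) \ Finset.range (k + 1))
      have h3 : ((S \ R).toFinite.toFinset.image (vcColor G w)).card ≤ (S \ R).ncard :=
        Finset.card_image_le.trans (Set.ncard_eq_toFinset_card _ _).ge
      have h4 : (S \ R).ncard + R.ncard = S.ncard :=
        Set.ncard_sdiff_add_ncard_of_subset fun s hs => hs.1
      simp only [Nat.card_Icc, Finset.card_range] at h1
      lia)
  simp only [Finset.mem_sdiff, Finset.mem_Icc, Finset.mem_range, Finset.mem_image,
    Set.Finite.mem_toFinset] at hc
  have hX (s : V) : ∃ X ⊆ F s, s ∈ R → X.ncard = c s - (D s).ncard := by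
    by_cases hs : s ∈ R
    · obtain ⟨X, hXF, hX⟩ := Set.exists_subset_card_eq (s := F s) (n := c s - (D s).ncard) (by
        have := hs.2
        have := (hc s hs).1.1
        lia)
      exact ⟨X, hXF, fun _ => hX⟩
    · exact ⟨∅, Set.empty_subset _, fun h => absurd h hs⟩
  choose X hXF hX using hX
  have hcolR {s : V} (hs : s ∈ R) : vcColor G (reweight w R F X) s = c s := by
    rw [vcColor_reweight_of_mem (S := S) G hXF (fun s hs => hs.1)
      (fun s => Set.disjoint_left.2 fun u hu => hu.2.1) (fun s u hu => hu.1) hs, hX s hs]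
    have := (hc s hs).1.1
    change (D s).ncard + _ = _
    lia
  have hcolS {s : V} (hs : s ∈ S) (hsR : s ∉ R) :
      vcColor G (reweight w R F X) s = vcColor G w s :=
    vcColor_reweight_eq_self G hXF hsR fun t _ h => h.2.1 hs
  have hcolP {v : V} (hv : v ∈ P) : vcColor G (reweight w R F X) v = vcColor G w v :=
    vcColor_reweight_eq_self G hXF (fun h => hPS hv h.1) fun t _ h => h.2.2.1 hv
  have hcolI {v : V} (hv : v ∉ S) : vcColor G (reweight w R F X) v ≤ k :=
    (vcColor_le_ncard_of_notMem hvc _ hv).trans hS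
  have hproper {s v : V} (hs : s ∈ S) (h : G.Adj s v) :
      vcColor G (reweight w R F X) s ≠ vcColor G (reweight w R F X) v := by
    by_cases hv : v ∈ S
    · by_cases hsR : s ∈ R <;> by_cases hvR : v ∈ R
      · rw [hcolR hsR, hcolR hvR]
        exact fun he => h.ne (hcinj hsR hvR he)
      · rw [hcolR hsR, hcolS hv hvR]
        exact fun he => (hc s hsR).2 ⟨v, ⟨hv, hvR⟩, he.symm⟩
      · rw [hcolS hs hsR, hcolR hvR]
        exact fun he => (hc v hvR).2 ⟨s, ⟨hs, hsR⟩, he⟩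
      · rw [hcolS hs hsR, hcolS hv hvR]
        exact hw s v h
    · have hvk := hcolI hv
      by_cases hsR : s ∈ R
      · rw [hcolR hsR]
        have := (hc s hsR).1.2
        lia
      · rw [hcolS hs hsR]
        by_cases hvP : v ∈ P
        · rw [hcolP hvP]
          exact hw s v h
        · have := hlarge hs (fun hsA => hvP (Set.mem_biUnion hsA ⟨h, hv⟩)) hsR
          lia
  refine ⟨reweight w R F X, fun u v h => ?_, fun e he => ?_, fun v => ?_⟩
  · rcases hvc h with hu | hv
    · exact hproper hu h
    · exact (hproper hv h.symm).symm
  · rw [reweight_eq_self hXF, hwE e he]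
    rintro s - u hu rfl
    exact hu.2.2.2 he
  · suffices vcColor G (reweight w R F X) v ≤ baseColor E₁ v + (3 * k ^ 2 + 3 * k) by lia
    have hDv := hDcard v
    by_cases hv : v ∈ S
    · by_cases hvR : v ∈ R
      · rw [hcolR hvR]
        have := (hc v hvR).1.1.2
        lia
      · rw [hcolS hv hvR]
        have hFv : (F v).ncard ≤ 2 * k := by
          by_contra! h
          exact hvR ⟨hv, h⟩
        have := hwD v
        lia
    · have := hcolI hv
      lia
end

section
/- Let G be a finite simple graph admitting a vertex cover of size at most k, and let E₁ ⊆ E(G). If there exists a proper weight function w : E(G) → {0,1} with w(e) = 1 for every e ∈ E₁, then there exists a proper weight function ŵ : E(G) → {0,1} with ŵ(e) = 1 for every e ∈ E₁ such that the number of edges e ∈ E(G) \ E₁ with ŵ(e) = 1 is at most k(8k² + 8k). -/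
variable {V : Type*}

open Finset

lemma vcColor_eq_card [Fintype V] (G : SimpleGraph V) (w : Sym2 V → Fin 2) (v : V) :
    vcColor G w v = Set.ncard {u | G.Adj v u ∧ w s(v, u) = 1} := by
  classical
  have h01 : ∀ x : Fin 2, (x : ℕ) = if x = 1 then 1 else 0 := by decide
  unfold vcColor
  simp only [h01, sum_boole, Nat.cast_id]
  rw [← Set.ncard_coe_finset, ← Set.ncard_image_of_injective (f := fun u => s(v, u)) _
    (fun a b h => Sym2.congr_right.1 h)]
  congr 1
  ext e
  simp only [coe_filter, Set.Finite.mem_toFinset, Set.mem_ofPred_eq, Set.mem_image]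
  constructor
  · rintro ⟨⟨he, hv⟩, hw⟩
    obtain ⟨u, rfl⟩ := Sym2.mem_iff_exists.1 hv
    exact ⟨u, ⟨he, hw⟩, rfl⟩
  · rintro ⟨u, ⟨hu, hw⟩, rfl⟩
    exact ⟨⟨hu, by simp⟩, hw⟩

lemma vcColor_congr [Fintype V] {G : SimpleGraph V} {w w' : Sym2 V → Fin 2} {v : V}
    (h : ∀ u, w s(v, u) = w' s(v, u)) : vcColor G w v = vcColor G w' v := by
  simp only [vcColor_eq_card, h]

/-- Vertices outside a vertex cover have color at most the size of the cover. -/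
lemma vcColor_le_card [Fintype V] {G : SimpleGraph V} {S : Finset V}
    (hvc : IsVertexCover G (S : Set V)) (w : Sym2 V → Fin 2) {v : V} (hv : v ∉ S) :
    vcColor G w v ≤ #S := by
  rw [vcColor_eq_card, ← Set.ncard_coe_finset]
  refine Set.ncard_le_ncard ?_ (Set.toFinite _)
  rintro u ⟨hu, -⟩
  exact (hvc hu).resolve_left (by simpa using hv)

/-- Greedy recoloring: the values of `col` on `A ⊆ S` can be replaced by values in prescribed
intervals of length `2k`, exceeding `k` and distinct from all other values on `S`. -/
lemma exists_recoloring [DecidableEq V] (S A : Finset V) (k : ℕ) (hA : A ⊆ S) (hS : #S ≤ k)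
    (f col : V → ℕ) :
    ∃ c : V → ℕ, (∀ v ∉ A, c v = col v) ∧ ∀ s ∈ A, f s ≤ c s ∧ c s ≤ f s + 2 * k ∧ k < c s ∧
      ∀ t ∈ S, t ≠ s → c s ≠ c t := by
  induction A using Finset.induction_on with
  | empty => exact ⟨col, by simp⟩
  | insert a A ha ih =>
    obtain ⟨c, hc, hcA⟩ := ih ((subset_insert a A).trans hA)
    have haS : a ∈ S := hA (mem_insert_self a A)
    obtain ⟨x, hx, hxn⟩ : ∃ x ∈ Icc (f a) (f a + 2 * k),
        x ∉ range (k + 1) ∪ (S.erase a).image c := by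
      apply exists_mem_notMem_of_card_lt_card
      have h1 := card_union_le (range (k + 1)) ((S.erase a).image c)
      have h2 : #((S.erase a).image c) ≤ #(S.erase a) := card_image_le
      have h3 := card_erase_add_one haS
      simp only [card_range, Nat.card_Icc] at *
      omega
    simp only [mem_union, mem_range, mem_image, mem_erase, not_or, not_exists, not_and,
      mem_Icc] at hx hxn
    refine ⟨Function.update c a x, fun v hv => ?_, fun s hs => ?_⟩
    · simp only [mem_insert, not_or] at hv
      rw [Function.update_of_ne hv.1, hc v hv.2]
    · by_cases hsa : s = a
      · subst hsa
        simp only [Function.update_self]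
        refine ⟨hx.1, hx.2, by omega, fun t ht hts => ?_⟩
        rw [Function.update_of_ne hts]
        exact fun h => hxn.2 t ⟨hts, ht⟩ h.symm
      · have hsA : s ∈ A := (mem_insert.1 hs).resolve_left hsa
        obtain ⟨h1, h2, h3, h4⟩ := hcA s hsA
        rw [Function.update_of_ne hsa]
        refine ⟨h1, h2, h3, fun t ht hts => ?_⟩
        by_cases hta : t = a
        · subst hta
          rw [Function.update_self]
          exact hxn.2 s ⟨hsa, hA hs⟩
        · rw [Function.update_of_ne hta]
          exact h4 t ht hts

open Classical in
/-- Neighbors of `s` outside `S` having no neighbor in `P`. -/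
noncomputable def freshNeighbors [Fintype V] (G : SimpleGraph V) (S P : Finset V) (s : V) :
    Finset V :=
  univ.filter fun u => G.Adj s u ∧ u ∉ S ∧ ∀ p ∈ P, ¬ G.Adj p u

lemma mem_freshNeighbors [Fintype V] {G : SimpleGraph V} {S P : Finset V} {s u : V} :
    u ∈ freshNeighbors G S P s ↔ G.Adj s u ∧ u ∉ S ∧ ∀ p ∈ P, ¬ G.Adj p u := by
  simp [freshNeighbors]

/-- There is a set `P ⊆ S` with few neighbors outside `S` such that every vertex of `S` outside
`P` has many neighbors outside `S` not adjacent to `P`. -/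
lemma exists_poor [Fintype V] (G : SimpleGraph V) (S : Finset V) (D : ℕ) :
    ∃ P ⊆ S, Set.ncard {u | u ∉ S ∧ ∃ p ∈ P, G.Adj p u} ≤ #S * D ∧
      ∀ s ∈ S, s ∉ P → D < #(freshNeighbors G S P s) := by
  classical
  obtain ⟨P, hP, hmax⟩ := (S.powerset.filter fun P =>
      Set.ncard {u | u ∉ S ∧ ∃ p ∈ P, G.Adj p u} ≤ #P * D).exists_max_image card
    ⟨∅, by simp⟩
  simp only [mem_filter, mem_powerset] at hP hmax
  refine ⟨P, hP.1, hP.2.trans (Nat.mul_le_mul_right _ (card_le_card hP.1)), fun s hs hsP => ?_⟩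
  by_contra! hle
  have hcard := card_insert_of_notMem hsP
  have := hmax (insert s P) ⟨insert_subset hs hP.1, ?_⟩
  · omega
  · have hsub : {u | u ∉ S ∧ ∃ p ∈ insert s P, G.Adj p u} ⊆
        {u | u ∉ S ∧ ∃ p ∈ P, G.Adj p u} ∪ freshNeighbors G S P s := by
      rintro u ⟨huS, p, hp, hpu⟩
      by_cases h : ∃ p ∈ P, G.Adj p u
      · exact Or.inl ⟨huS, h⟩
      · push Not at h
        rcases mem_insert.1 hp with rfl | hp
        · exact Or.inr (mem_coe.2 (mem_freshNeighbors.2 ⟨hpu, huS, h⟩))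
        · exact absurd hpu (h p hp)
    have h1 := (Set.ncard_le_ncard hsub (Set.toFinite _)).trans (Set.ncard_union_le _ _)
    rw [Set.ncard_coe_finset] at h1
    rw [hcard]
    linarith [hP.2, Nat.succ_mul (#P) D]

/-- If every vertex of a vertex cover `S` is incident to at most `b` edges satisfying `p`, then at
most `#S * b` edges satisfy `p`. -/
lemma ncard_edges_le [Fintype V] {G : SimpleGraph V} {S : Finset V}
    (hvc : IsVertexCover G (S : Set V)) (p : Sym2 V → Prop) (b : ℕ)
    (h : ∀ s ∈ S, Set.ncard {u | G.Adj s u ∧ p s(s, u)} ≤ b) :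
    Set.ncard {e | e ∈ G.edgeSet ∧ p e} ≤ #S * b := by
  classical
  have hsub : {e | e ∈ G.edgeSet ∧ p e} ⊆
      ((S.biUnion fun s => (univ.filter fun u => G.Adj s u ∧ p s(s, u)).image fun u => s(s, u) :
        Finset (Sym2 V)) : Set (Sym2 V)) := by
    rintro e ⟨he, hp⟩
    induction e with | _ x y
    simp only [coe_biUnion, Set.mem_iUnion, coe_image, Set.mem_image, coe_filter, mem_univ,
      true_and, Set.mem_ofPred_eq, mem_coe]
    rcases hvc he with hx | hy
    · exact ⟨x, hx, y, ⟨he, hp⟩, rfl⟩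
    · exact ⟨y, hy, x, ⟨G.adj_symm he, by rwa [Sym2.eq_swap]⟩, Sym2.eq_swap⟩
  refine (Set.ncard_le_ncard hsub (Set.toFinite _)).trans ?_
  rw [Set.ncard_coe_finset]
  refine card_biUnion_le_card_mul _ _ _ fun s hs => card_image_le.trans ?_
  rw [← Set.ncard_coe_finset]
  simpa using h s hs

open Classical in
/-- The weighting obtained from `w` by resetting, for each `s ∈ A`, the edges from `s` to `M s` so
that exactly those to `T s` have weight `1`. -/
noncomputable def resetWeight (w : Sym2 V → Fin 2) (A : Finset V) (M T : V → Finset V)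
    (e : Sym2 V) : Fin 2 :=
  if ∃ s ∈ A, ∃ u ∈ M s, e = s(s, u) then
    if ∃ s ∈ A, ∃ u ∈ T s, e = s(s, u) then 1 else 0
  else w e

section resetWeight

variable {w : Sym2 V → Fin 2} {S A : Finset V} {M T : V → Finset V}

lemma resetWeight_of_notMem {v : V} (hvA : v ∉ A) (hvM : ∀ s ∈ A, v ∉ M s) (u : V) :
    resetWeight w A M T s(v, u) = w s(v, u) := by
  refine if_neg ?_
  rintro ⟨s, hs, x, hx, h⟩
  rcases Sym2.eq_iff.1 h with ⟨rfl, rfl⟩ | ⟨rfl, rfl⟩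
  · exact hvA hs
  · exact hvM _ hs hx

lemma exists_mk_eq_iff (hA : A ⊆ S) {N : V → Finset V} (hN : ∀ s, ∀ u ∈ N s, u ∉ S) {s u : V}
    (hs : s ∈ A) : (∃ t ∈ A, ∃ x ∈ N t, s(s, u) = s(t, x)) ↔ u ∈ N s := by
  constructor
  · rintro ⟨t, ht, x, hx, h⟩
    rcases Sym2.eq_iff.1 h with ⟨rfl, rfl⟩ | ⟨rfl, rfl⟩
    · exact hx
    · exact absurd (hA hs) (hN _ _ hx)
  · exact fun h => ⟨s, hs, u, h, rfl⟩

lemma resetWeight_eq_one_iff (hA : A ⊆ S) (hM : ∀ s, ∀ u ∈ M s, u ∉ S)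
    (hT : ∀ s, T s ⊆ M s) {s u : V} (hs : s ∈ A) :
    resetWeight w A M T s(s, u) = 1 ↔ u ∈ T s ∨ u ∉ M s ∧ w s(s, u) = 1 := by
  have h1 := exists_mk_eq_iff hA hM hs (u := u)
  have h2 := exists_mk_eq_iff hA (fun s u hu => hM s u (hT s hu)) hs (u := u)
  have h3 := @hT s u
  unfold resetWeight
  split_ifs with hm ht
  · simp [h2.1 ht]
  · simp [mt h2.2 ht, h1.1 hm]
  · simp [mt h1.2 hm, mt h3 (mt h1.2 hm)]

lemma vcColor_resetWeight [Fintype V] {G : SimpleGraph V} (hA : A ⊆ S)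
    (hM : ∀ s, ∀ u ∈ M s, u ∉ S) (hMG : ∀ s, ∀ u ∈ M s, G.Adj s u)
    (hT : ∀ s, T s ⊆ M s) {s : V} (hs : s ∈ A) :
    vcColor G (resetWeight w A M T) s =
      Set.ncard {u | G.Adj s u ∧ u ∉ M s ∧ w s(s, u) = 1} + #(T s) := by
  rw [vcColor_eq_card, ← Set.ncard_coe_finset, ← Set.ncard_union_eq]
  · congr 1
    ext u
    simp only [resetWeight_eq_one_iff hA hM hT hs, Set.mem_ofPred_eq, Set.mem_union, mem_coe]
    have := hMG s u
    have := @hT s u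
    tauto
  · rw [Set.disjoint_left]
    rintro u ⟨-, hu, -⟩ huT
    exact hu (hT s huT)

end resetWeight

/-- If `G` has a vertex cover of size at most `k` and admits a proper
weighting extending the all-ones pre-weighting on `E₁`, then it admits such a weighting
assigning weight `1` to at most `k(8k² + 8k)` edges outside `E₁`. -/
theorem stmt_14 [Finite V] (G : SimpleGraph V) (k : ℕ) (S : Set V)
    (hvc : IsVertexCover G S) (hS : S.ncard ≤ k)
    (E₁ : Set (Sym2 V)) (hE₁ : E₁ ⊆ G.edgeSet)
    (hex : ∃ w : Sym2 V → Fin 2, vcProper G w ∧ ∀ e ∈ E₁, w e = 1) :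
    ∃ w2 : Sym2 V → Fin 2, vcProper G w2 ∧ (∀ e ∈ E₁, w2 e = 1) ∧
      {e | e ∈ G.edgeSet ∧ e ∉ E₁ ∧ w2 e = 1}.ncard ≤ k * (8 * k ^ 2 + 8 * k) := by
  classical
  have := Fintype.ofFinite V
  obtain ⟨w, hw, hwE⟩ := hex
  lift S to Finset V using S.toFinite
  rw [Set.ncard_coe_finset] at hS
  obtain ⟨P, -, hPcard, hP⟩ := exists_poor G S (3 * k)
  set M : V → Finset V := fun s => (freshNeighbors G S P s).filter fun u => s(s, u) ∉ E₁ with hMdef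
  have mem_M : ∀ {s u}, u ∈ M s ↔
      (G.Adj s u ∧ u ∉ S ∧ ∀ p ∈ P, ¬ G.Adj p u) ∧ s(s, u) ∉ E₁ := by
    simp [hMdef, mem_freshNeighbors]
  have hMS : ∀ s, ∀ u ∈ M s, u ∉ S := fun s u hu => (mem_M.1 hu).1.2.1
  set A : Finset V := S.filter fun s => s ∉ P ∧ 2 * k ≤ #(M s) with hAdef
  have hAS : A ⊆ S := filter_subset _ _
  obtain ⟨c, hc, hcA⟩ := exists_recoloring S A k hAS hS
    (fun s => Set.ncard {u | G.Adj s u ∧ u ∉ M s ∧ w s(s, u) = 1}) (vcColor G w)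
  have hTex : ∀ s, ∃ T ⊆ M s, s ∈ A →
      Set.ncard {u | G.Adj s u ∧ u ∉ M s ∧ w s(s, u) = 1} + #T = c s ∧ #T ≤ 2 * k := by
    intro s
    by_cases hs : s ∈ A
    · obtain ⟨h1, h2, -⟩ := hcA s hs
      obtain ⟨T, hT, hTc⟩ := exists_subset_card_eq (s := M s)
        (n := c s - Set.ncard {u | G.Adj s u ∧ u ∉ M s ∧ w s(s, u) = 1})
        (by have := (mem_filter.1 hs).2.2; omega)
      exact ⟨T, hT, fun _ => by omega⟩
    · exact ⟨∅, by simp, fun h => absurd h hs⟩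
  choose T hTM hT using hTex
  have color_S : ∀ s ∈ S, vcColor G (resetWeight w A M T) s = c s := by
    intro s hs
    by_cases hsA : s ∈ A
    · rw [vcColor_resetWeight hAS hMS (fun s u hu => (mem_M.1 hu).1.1) hTM hsA, (hT s hsA).1]
    · rw [hc s hsA]
      exact vcColor_congr (resetWeight_of_notMem hsA fun t _ h => hMS t s h hs)
  have lt_color : ∀ s ∈ S, s ∉ P → k < c s := by
    intro s hs hsP
    by_cases hsA : s ∈ A
    · exact (hcA s hsA).2.2.1
    · have hMlt : #(M s) < 2 * k := by
        by_contra! h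
        exact hsA (mem_filter.2 ⟨hs, hsP, h⟩)
      have hsplit := card_filter_add_card_filter_not (s := freshNeighbors G S P s)
        (fun u => s(s, u) ∉ E₁)
      have hle : #((freshNeighbors G S P s).filter fun u => ¬ s(s, u) ∉ E₁) ≤ vcColor G w s := by
        rw [vcColor_eq_card, ← Set.ncard_coe_finset]
        refine Set.ncard_le_ncard (fun u hu => ?_) (Set.toFinite _)
        simp only [coe_filter, not_not, mem_freshNeighbors, Set.mem_ofPred_eq] at hu
        exact ⟨hu.1.1, hwE _ hu.2⟩
      have := hP s hs hsP
      rw [hc s hsA]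
      simp only [hMdef] at hMlt
      omega
  have ne_outside : ∀ s i, s ∈ S → i ∉ S → G.Adj s i →
      vcColor G (resetWeight w A M T) s ≠ vcColor G (resetWeight w A M T) i := by
    intro s i hs hi hsi
    by_cases hsP : s ∈ P
    · have hsA : s ∉ A := fun h => (mem_filter.1 h).2.1 hsP
      rw [color_S s hs, hc s hsA, vcColor_congr (w := resetWeight w A M T)
        (resetWeight_of_notMem (fun h => hi (hAS h)) fun t _ h => (mem_M.1 h).1.2.2 s hsP hsi)]
      exact hw s i hsi
    · have h1 := lt_color s hs hsP
      have h2 := vcColor_le_card hvc (resetWeight w A M T) hi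
      rw [color_S s hs]
      omega
  refine ⟨resetWeight w A M T, fun u v huv => ?_, fun e he => ?_, ?_⟩
  · by_cases hu : u ∈ S
    · by_cases hv : v ∈ S
      · rw [color_S u hu, color_S v hv]
        by_cases huA : u ∈ A
        · exact (hcA u huA).2.2.2 v hv huv.ne'
        by_cases hvA : v ∈ A
        · exact ((hcA v hvA).2.2.2 u hu huv.ne).symm
        · rw [hc u huA, hc v hvA]
          exact hw u v huv
      · exact ne_outside u v hu hv huv
    · exact (ne_outside v u ((hvc huv).resolve_left (by simpa using hu)) hu huv.symm).symm
  · unfold resetWeight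
    rw [if_neg, hwE e he]
    rintro ⟨s, -, u, hu, rfl⟩
    exact (mem_M.1 hu).2 he
  · refine (ncard_edges_le hvc _ (8 * k ^ 2 + 8 * k) fun s hs => ?_).trans
      (Nat.mul_le_mul_right _ hS)
    obtain ⟨F, hF, hFsub⟩ : ∃ F : Finset V, #F ≤ 2 * k ∧
        ∀ u ∈ M s, resetWeight w A M T s(s, u) = 1 → s ∉ P → u ∈ F := by
      by_cases hsA : s ∈ A
      · refine ⟨T s, (hT s hsA).2, fun u hu h1 _ => ?_⟩
        exact ((resetWeight_eq_one_iff hAS hMS hTM hsA).1 h1).resolve_right fun h => h.1 hu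
      · by_cases hsP : s ∈ P
        · exact ⟨∅, by simp, fun u _ _ h => absurd hsP h⟩
        · refine ⟨M s, ?_, fun u hu _ _ => hu⟩
          by_contra! h
          exact hsA (mem_filter.2 ⟨hs, hsP, h.le⟩)
    have hsub : {u | G.Adj s u ∧ s(s, u) ∉ E₁ ∧ resetWeight w A M T s(s, u) = 1} ⊆
        ((S ∪ F : Finset V) : Set V) ∪ {u | u ∉ S ∧ ∃ p ∈ P, G.Adj p u} := by
      rintro u ⟨hsu, huE, hu1⟩
      by_cases huS : u ∈ S
      · exact Or.inl (by simp [huS])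
      by_cases huP : ∃ p ∈ P, G.Adj p u
      · exact Or.inr ⟨huS, huP⟩
      push Not at huP
      exact Or.inl (by
        simp [hFsub u (mem_M.2 ⟨⟨hsu, huS, huP⟩, huE⟩) hu1 fun h => huP s h hsu])
    have h1 := (Set.ncard_le_ncard hsub (Set.toFinite _)).trans (Set.ncard_union_le _ _)
    rw [Set.ncard_coe_finset] at h1
    have h2 := card_union_le S F
    have h3 : #S * (3 * k) ≤ k * (3 * k) := Nat.mul_le_mul_right _ hS
    nlinarith
end
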